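/- Let q be any prime power and z ∈ F_q with z ≠ 0 such that the quadratic x² + x − z has two distinct roots in F_q. Then ∑_{0 ≤ l ≤ (q−1)/2} binom(l+2, 2)·binom(−l, l+1)·z^l equals 0 if q = 2, and equals 3z(1 + 2z)/(1 + 4z)² if q > 2. -/

import Mathlib

namespace Nat

theorem choose_two_mul_choose_succ_mul_two (l : ℕ) :
    (l + 2).choose 2 * (2 * l).choose (l + 1) * 2 = l * (l + 2) * centralBinom l := by
  have h := Nat.choose_succ_right_eq (2 * l) l
  have hl : 2 * l - l = l := by omega
  rw [hl] at h
  have h2 : (l + 2).choose 2 * 2 = (l + 2) * (l + 1) := by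
    have := Nat.choose_succ_right_eq (l + 2) 1
    simpa using this
  rw [centralBinom_eq_two_mul_choose]
  linear_combination (l + 2) * h + (2 * l).choose (l + 1) * h2

theorem four_dvd_mul_centralBinom {l : ℕ} (hl : 2 ≤ l) : 4 ∣ l * centralBinom l := by
  obtain ⟨m, rfl⟩ : ∃ m, l = m + 1 := ⟨l - 1, by omega⟩
  rw [succ_mul_centralBinom_succ]
  obtain ⟨c, hc⟩ := two_dvd_centralBinom_of_one_le (n := m) (by omega)
  exact ⟨(2 * m + 1) * c, by rw [hc]; ring⟩

theorem even_choose_two_mul_choose_succ {l : ℕ} (hl : 2 ≤ l) :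
    Even ((l + 2).choose 2 * (2 * l).choose (l + 1)) := by
  have h := choose_two_mul_choose_succ_mul_two l
  obtain ⟨c, hc⟩ := four_dvd_mul_centralBinom hl
  refine ⟨(l + 2) * c, ?_⟩
  linarith [show l * (l + 2) * centralBinom l = (l + 2) * (4 * c) by rw [← hc]; ring]

end Nat

theorem Ring.choose_neg_natCast_succ (l : ℕ) :
    Ring.choose (-(l : ℤ)) (l + 1) = (-1) ^ (l + 1) * ((2 * l).choose (l + 1) : ℤ) := by
  rw [Ring.choose_neg, show (l : ℤ) + ((l + 1 : ℕ) : ℤ) - 1 = ((2 * l : ℕ) : ℤ) by push_cast; ring,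
    Ring.choose_natCast, Int.negOnePow_def, Units.smul_def, smul_eq_mul, zpow_natCast]
  simp

namespace PowerSeries

theorem mk_centralBinom_sq_mul_one_sub_four_mul_X (R : Type*) [CommRing R] :
    (mk fun l => (Nat.centralBinom l : R)) ^ 2 * (1 - 4 * X) = 1 := by
  suffices h : (mk fun l => (Nat.centralBinom l : ℤ)) ^ 2 * (1 - 4 * X) = 1 by
    have h' := congrArg (map (Int.castRingHom R)) h
    have hB : map (Int.castRingHom R) (mk fun l => (Nat.centralBinom l : ℤ)) =
        mk fun l => (Nat.centralBinom l : R) := by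
      ext l; simp
    have h4 : map (Int.castRingHom R) 4 = 4 := map_ofNat _ 4
    simpa [hB, h4] using h'
  set B : ℤ⟦X⟧ := mk fun l => (Nat.centralBinom l : ℤ) with hB
  have hD : d⁄dX ℤ (1 - 4 * X : ℤ⟦X⟧) = -4 := by
    have h4 : (4 : ℤ⟦X⟧) = C 4 := by simp
    rw [h4, map_sub, Derivation.leibniz, derivative_C, derivative_X, derivative_one]
    simp
  have hODE : d⁄dX ℤ B * (1 - 4 * X) = 2 * B := by
    have h4 : (4 : ℤ⟦X⟧) = C 4 := by simp
    have h2 : (2 : ℤ⟦X⟧) = C 2 := by simp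
    have e : d⁄dX ℤ B * (1 - 4 * X) = d⁄dX ℤ B - C 4 * (d⁄dX ℤ B * X) := by rw [h4]; ring
    rw [e, h2]
    ext l
    have hs := congrArg (Nat.cast : ℕ → ℤ) (Nat.succ_mul_centralBinom_succ l)
    push_cast at hs
    cases l with
    | zero =>
      rw [map_sub, coeff_C_mul, coeff_zero_mul_X, coeff_C_mul, coeff_derivative]
      simp [hB, Nat.centralBinom]
    | succ m =>
      simp only [map_sub, coeff_C_mul, coeff_succ_mul_X, coeff_derivative, hB, coeff_mk]
      push_cast at hs ⊢
      linear_combination hs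
  apply derivative.ext
  · rw [Derivation.leibniz, derivative_pow, hD, derivative_one]
    simp only [smul_eq_mul]
    push_cast
    linear_combination 2 * B * hODE
  · simp [hB]

end PowerSeries

open PowerSeries in
theorem Nat.cast_centralBinom_eq_neg_four_pow_mul_choose {F : Type*} [Field F] [Fintype F] {n l : ℕ}
    (hq : Fintype.card F = 2 * n + 1) (hl : l ≤ n) :
    (Nat.centralBinom l : F) = (-4) ^ l * (n.choose l : F) := by
  obtain ⟨p, hp⟩ := CharP.exists F
  obtain ⟨k, hprime, hk⟩ := FiniteField.card F p
  have : Fact p.Prime := ⟨hprime⟩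
  have : CharP F⟦X⟧ p := charP_of_injective_algebraMap (algebraMap F F⟦X⟧).injective p
  set B : F⟦X⟧ := mk fun l => (Nat.centralBinom l : F) with hB
  have hsq := mk_centralBinom_sq_mul_one_sub_four_mul_X F
  rw [← hB] at hsq
  obtain ⟨D, hD⟩ : X ∣ B - 1 := by
    rw [X_dvd_iff]; simp [hB]
  have hpow : B ^ (2 * n + 1) = 1 + X ^ (2 * n + 1) * D ^ (2 * n + 1) := by
    have : B = 1 + X * D := by rw [← hD]; ring
    rw [← mul_pow, this, ← hq, hk, add_pow_char_pow, one_pow]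
  have hmain : B = (1 - 4 * X) ^ n + X ^ (2 * n + 1) * (D ^ (2 * n + 1) * (1 - 4 * X) ^ n) :=
    calc B = B * (B ^ 2 * (1 - 4 * X)) ^ n := by rw [hsq, one_pow, mul_one]
      _ = B ^ (2 * n + 1) * (1 - 4 * X) ^ n := by rw [mul_pow, ← pow_mul]; ring
      _ = _ := by rw [hpow]; ring
  have hc := congrArg (coeff l) hmain
  have hexp : (1 - 4 * X : F⟦X⟧) ^ n =
      ∑ m ∈ Finset.range (n + 1), C ((-4) ^ m * (n.choose m : F)) * X ^ m := by
    rw [show (1 - 4 * X : F⟦X⟧) = (-4) * X + 1 by ring, add_pow]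
    refine Finset.sum_congr rfl fun m _ => ?_
    simp only [one_pow, mul_one, map_mul, map_pow, map_neg, map_ofNat, map_natCast, mul_pow]
    ring
  rw [map_add, coeff_X_pow_mul', if_neg (by omega), add_zero, hexp, map_sum] at hc
  simp only [coeff_C_mul_X_pow] at hc
  rw [Finset.sum_ite_eq, if_pos (Finset.mem_range.2 (by omega))] at hc
  simpa [hB] using hc

open Polynomial in
theorem sum_mul_add_two_mul_choose_mul_pow {R : Type*} [CommRing R] (n : ℕ) (w : R) :
    (1 + w) ^ 2 * ∑ l ∈ Finset.range (n + 1), (l : R) * (l + 2) * (n.choose l : R) * w ^ l =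
      (n * (n - 1) * w ^ 2 + 3 * n * w * (1 + w)) * (1 + w) ^ n := by
  set P : R[X] := (X + 1) ^ n with hP
  have h1 : derivative P * (X + 1) = (n : R[X]) * P := by
    cases n with
    | zero => simp [hP]
    | succ n => simp [hP, derivative_pow]; ring
  have h2 : derivative (derivative P) * (X + 1) + derivative P = (n : R[X]) * derivative P := by
    simpa using congrArg derivative h1
  have hsum : P = ∑ l ∈ Finset.range (n + 1), C (n.choose l : R) * X ^ l := by
    rw [hP, add_pow]
    refine Finset.sum_congr rfl fun l _ => ?_
    simp [mul_comm]
  have h3 : ∑ l ∈ Finset.range (n + 1), (l : R) * (l + 2) * (n.choose l : R) * w ^ l =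
      w ^ 2 * (derivative (derivative P)).eval w + 3 * w * (derivative P).eval w := by
    rw [hsum]
    simp only [derivative_sum, eval_finsetSum, Finset.mul_sum, ← Finset.sum_add_distrib]
    refine Finset.sum_congr rfl fun l _ => ?_
    rcases l with _ | _ | l
    · simp
    · simp; ring
    · simp; ring
  have e0 : P.eval w = (1 + w) ^ n := by simp [hP, add_comm]
  have e1 := congrArg (eval w) h1
  have e2 := congrArg (eval w) h2
  simp only [eval_mul, eval_add, eval_X, eval_one, eval_natCast] at e1 e2
  rw [h3, ← e0]
  linear_combination (w ^ 2 * (n - 1) + 3 * w * (1 + w)) * e1 + w ^ 2 * (1 + w) * e2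


/-- **Lemma A.1** (Hou). Let `z ∈ F_q^*` be such that `x² + x − z` has two distinct
roots in `F_q`. Then `∑_{0 ≤ l ≤ ⌊(q−1)/2⌋} binom(l+2, 2)·binom(−l, l+1)·z^l` equals
`0` if `q = 2`, and equals `3z(1 + 2z)/(1 + 4z)²` if `q > 2`. -/
theorem binom_sum_l_add_two_choose_two_neg_l_l_add_one
    (q : ℕ)
    (F : Type*) [Field F] [Fintype F]
    (hF : Fintype.card F = q)
    (z : F) (hz : z ≠ 0)
    (hroots : ∃ r s : F, r ≠ s ∧ r ^ 2 + r - z = 0 ∧ s ^ 2 + s - z = 0) :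
    (q = 2 →
      ∑ l ∈ Finset.range ((q - 1) / 2 + 1),
        ((l + 2).choose 2 : F) * ((Ring.choose (-(l : ℤ)) (l + 1) : ℤ) : F) * z ^ l
        = 0) ∧
    (2 < q →
      ∑ l ∈ Finset.range ((q - 1) / 2 + 1),
        ((l + 2).choose 2 : F) * ((Ring.choose (-(l : ℤ)) (l + 1) : ℤ) : F) * z ^ l
        = 3 * z * (1 + 2 * z) / (1 + 4 * z) ^ 2) := by
  subst hF
  have hterm : ∀ l : ℕ, ((l + 2).choose 2 : F) * ((Ring.choose (-(l : ℤ)) (l + 1) : ℤ) : F) * z ^ l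
      = (-1) ^ (l + 1) * (((l + 2).choose 2 * (2 * l).choose (l + 1) : ℕ) : F) * z ^ l := by
    intro l
    rw [Ring.choose_neg_natCast_succ]
    push_cast
    ring
  refine ⟨fun h2 => by simp [h2], fun hq => ?_⟩
  simp only [hterm]
  by_cases hchar : ringChar F = 2
  · have h2 : (2 : F) = 0 := by
      have := ringChar.Nat.cast_ringChar (R := F)
      rw [hchar] at this
      exact_mod_cast this
    have hcard := (FiniteField.even_card_iff_char_two (F := F)).1 hchar
    rw [Finset.sum_eq_single_of_mem 1 (Finset.mem_range.2 (by omega))]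
    · have h4 : (4 : F) = 0 := by linear_combination 2 * h2
      simp [h2, h4]
    · intro l _ hl
      rcases Nat.lt_or_ge l 2 with h | h
      · obtain rfl : l = 0 := by omega
        simp
      · obtain ⟨c, hc⟩ := Nat.even_choose_two_mul_choose_succ h
        rw [hc, ← two_mul, Nat.cast_mul, Nat.cast_ofNat, h2]
        ring
  · have h2 : (2 : F) ≠ 0 := Ring.two_ne_zero hchar
    have hodd := FiniteField.odd_card_of_char_ne_two hchar
    obtain ⟨n, hn⟩ : ∃ n, Fintype.card F = 2 * n + 1 := ⟨Fintype.card F / 2, by omega⟩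
    have hn0 : (2 * n + 1 : F) = 0 := by
      have := FiniteField.cast_card_eq_zero F
      rw [hn] at this
      exact_mod_cast this
    obtain ⟨r, s, hrs, hr, hs⟩ := hroots
    have hrs0 : r - s ≠ 0 := sub_ne_zero.2 hrs
    have hsum : r + s = -1 := by
      apply mul_left_cancel₀ hrs0
      linear_combination hr - hs
    have hdisc : 1 + 4 * z = (r - s) ^ 2 := by
      linear_combination (r + s + 1) * hsum - 2 * hr - 2 * hs
    have hd0 : 1 + 4 * z ≠ 0 := by rw [hdisc]; exact pow_ne_zero 2 hrs0
    have hpow : (1 + 4 * z) ^ n = 1 := by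
      rw [hdisc, ← pow_mul]
      have := FiniteField.pow_card_sub_one_eq_one (r - s) hrs0
      rwa [hn, Nat.add_sub_cancel] at this
    have hrange : (Fintype.card F - 1) / 2 + 1 = n + 1 := by omega
    rw [hrange, eq_div_iff (pow_ne_zero 2 hd0)]
    have hS := sum_mul_add_two_mul_choose_mul_pow n (4 * z)
    rw [hpow] at hS
    have hL : 2 * ∑ l ∈ Finset.range (n + 1),
        (-1) ^ (l + 1) * (((l + 2).choose 2 * (2 * l).choose (l + 1) : ℕ) : F) * z ^ l =
        -∑ l ∈ Finset.range (n + 1), (l : F) * (l + 2) * (n.choose l : F) * (4 * z) ^ l := by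
      rw [Finset.mul_sum, ← Finset.sum_neg_distrib]
      refine Finset.sum_congr rfl fun l hl => ?_
      have hb := Nat.cast_centralBinom_eq_neg_four_pow_mul_choose hn
        (Nat.lt_succ_iff.1 (Finset.mem_range.1 hl))
      have hc := congrArg (Nat.cast : ℕ → F) (Nat.choose_two_mul_choose_succ_mul_two l)
      rw [Nat.cast_mul] at hc
      push_cast [hb] at hc ⊢
      have h4 : (4 : F) ^ l = (-1) ^ l * (-4) ^ l := by rw [← mul_pow]; norm_num
      rw [mul_pow, h4]
      linear_combination (-1) ^ (l + 1) * z ^ l * hc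
    have h8 : (8 : F) ≠ 0 := by
      rw [show (8 : F) = 2 ^ 3 by norm_num]
      exact pow_ne_zero 3 h2
    apply mul_left_cancel₀ h8
    have hn' : (n : F) * 2 = -1 := by linear_combination hn0
    linear_combination 4 * (1 + 4 * z) ^ 2 * hL - 4 * hS
      - ((2 * n - 3) * 16 * z ^ 2 + 24 * z * (1 + 4 * z)) * hn'
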